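/- arXiv:2112.14682 — 4 statements merged into one kernel-verified Lean document; each statement's English description precedes it below -/
import Mathlib

section
/- For every multilinear polynomial p : ℝ^n → ℂ (a polynomial in n variables with complex coefficients in which every variable occurs with degree at most 1), there exists a univariate polynomial q over ℂ with deg(q) ≤ deg(p) such that for every k ∈ {0, 1, ..., n}, q(k) equals the average of p(x) over all x ∈ {0,1}^n with Hamming weight |x| = k, i.e., q(k) = (1/C(n,k)) · Σ_{x ∈ {0,1}^n, |x| = k} p(x). -/
/-- Hamming weight of a Boolean string. -/
def hamWt {n : ℕ} (x : Fin n → Bool) : ℕ :=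
  (Finset.univ.filter (fun i => x i = true)).card

/-- View a Boolean string as a 0/1 complex input. -/
def bval {n : ℕ} (x : Fin n → Bool) : Fin n → ℂ :=
  fun i => if x i then 1 else 0

theorem card_filter_subset_powersetCard_univ_mul_choose {α : Type*} [Fintype α] [DecidableEq α]
    (S : Finset α) (k : ℕ) :
    ((Finset.powersetCard k Finset.univ).filter (fun T => S ⊆ T)).card *
        (Fintype.card α).choose S.card =
      (Fintype.card α).choose k * k.choose S.card := by
  rcases lt_or_ge k S.card with h | h
  · rw [Nat.choose_eq_zero_of_lt h, Finset.filter_false_of_mem, Finset.card_empty, zero_mul,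
      mul_zero]
    intro T hT hST
    have := Finset.card_le_card hST
    rw [(Finset.mem_powersetCard.mp hT).2] at this
    omega
  · rw [Nat.choose_mul h, mul_comm, ← Finset.card_compl, ← Finset.card_powersetCard]
    congr 1
    refine Finset.card_bij' (fun T _ => T \ S) (fun T _ => T ∪ S) ?_ ?_ ?_ ?_
    · intro T hT
      simp only [Finset.mem_filter, Finset.mem_powersetCard] at hT ⊢
      refine ⟨fun i hi => ?_, ?_⟩
      · simpa using (Finset.mem_sdiff.mp hi).2
      · rw [Finset.card_sdiff_of_subset hT.2, hT.1.2]
    · intro T hT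
      simp only [Finset.mem_filter, Finset.mem_powersetCard] at hT ⊢
      refine ⟨⟨Finset.subset_univ _, ?_⟩, Finset.subset_union_right⟩
      rw [Finset.card_union_of_disjoint (Finset.subset_compl_iff_disjoint_right.mp hT.1), hT.2]
      omega
    · intro T hT
      exact Finset.sdiff_union_of_subset (Finset.mem_filter.mp hT).2
    · intro T hT
      rw [Finset.mem_powersetCard] at hT
      exact Finset.union_sdiff_cancel_right (Finset.subset_compl_iff_disjoint_right.mp hT.1)

theorem prod_bval_pow {n : ℕ} (x : Fin n → Bool) (m : Fin n →₀ ℕ) :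
    ∏ i, bval x i ^ m i =
      if m.support ⊆ Finset.univ.filter (fun i => x i = true) then 1 else 0 := by
  split_ifs with h
  · refine Finset.prod_eq_one fun i _ => ?_
    by_cases hi : m i = 0
    · simp [hi]
    · have : x i = true := (Finset.mem_filter.mp (h (Finsupp.mem_support_iff.mpr hi))).2
      simp [bval, this]
  · obtain ⟨i, hi, hx⟩ := Finset.not_subset.mp h
    refine Finset.prod_eq_zero (Finset.mem_univ i) ?_
    rw [Finsupp.mem_support_iff] at hi
    simp_all [bval]

theorem sum_hamWt_prod_bval_pow {n : ℕ} (k : ℕ) (m : Fin n →₀ ℕ) :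
    ∑ x ∈ Finset.univ.filter (fun x : Fin n → Bool => hamWt x = k), ∏ i, bval x i ^ m i =
      (((Finset.powersetCard k Finset.univ).filter (fun T => m.support ⊆ T)).card : ℂ) := by
  simp only [prod_bval_pow]
  rw [Finset.sum_boole]
  congr 1
  refine Finset.card_bij' (fun x _ => Finset.univ.filter (fun i => x i = true))
    (fun T _ i => decide (i ∈ T)) ?_ ?_ ?_ ?_
  · intro x hx
    simp only [Finset.mem_filter, Finset.mem_powersetCard] at hx ⊢
    simpa [hamWt] using hx
  · intro T hT
    simp only [Finset.mem_filter, Finset.mem_powersetCard] at hT ⊢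
    simpa [hamWt] using hT
  · intro x _
    simp
  · intro T _
    simp

theorem card_support_le_totalDegree {σ R : Type*} [CommSemiring R] {p : MvPolynomial σ R}
    {m : σ →₀ ℕ} (hm : m ∈ p.support) : m.support.card ≤ p.totalDegree := by
  refine le_trans ?_ (MvPolynomial.le_totalDegree hm)
  rw [Finset.card_eq_sum_ones]
  exact Finset.sum_le_sum fun i hi => Nat.one_le_iff_ne_zero.mpr (Finsupp.mem_support_iff.mp hi)


/-- Minsky–Papert symmetrization: for every multilinear polynomial `p` in `n`
variables over `ℂ` there is a univariate polynomial `q` of degree at most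
`deg p` such that `q(k)` is the average of `p` over Boolean inputs of Hamming
weight `k`, for every `k ∈ {0, …, n}`. -/
theorem stmt_0 (n : ℕ) (p : MvPolynomial (Fin n) ℂ)
    (hml : ∀ i : Fin n, p.degreeOf i ≤ 1) :
    ∃ q : Polynomial ℂ, q.natDegree ≤ p.totalDegree ∧
      ∀ k : ℕ, k ≤ n →
        q.eval (k : ℂ) =
          (1 / (n.choose k : ℂ)) *
            ∑ x ∈ Finset.univ.filter (fun x : Fin n → Bool => hamWt x = k),
              MvPolynomial.eval (bval x) p := by
  refine ⟨∑ m ∈ p.support, Polynomial.C (p.coeff m / (n.descFactorial m.support.card : ℂ)) *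
    descPochhammer ℂ m.support.card, ?_, ?_⟩
  · refine Polynomial.natDegree_sum_le_of_forall_le _ _ fun m hm => ?_
    refine (Polynomial.natDegree_C_mul_le _ _).trans ?_
    rw [descPochhammer_natDegree]
    exact card_support_le_totalDegree hm
  · intro k hk
    simp only [MvPolynomial.eval_eq']
    rw [Finset.sum_comm, Finset.mul_sum, Polynomial.eval_finsetSum]
    refine Finset.sum_congr rfl fun m _ => ?_
    rw [← Finset.mul_sum, sum_hamWt_prod_bval_pow, Polynomial.eval_mul, Polynomial.eval_C,
      descPochhammer_eval_eq_descFactorial, Nat.descFactorial_eq_factorial_mul_choose,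
      Nat.descFactorial_eq_factorial_mul_choose]
    have hcount := card_filter_subset_powersetCard_univ_mul_choose m.support k
    rw [Fintype.card_fin] at hcount
    have hs : m.support.card ≤ n := by simpa using Finset.card_le_univ m.support
    have hns : (n.choose m.support.card : ℂ) ≠ 0 :=
      Nat.cast_ne_zero.mpr (Nat.choose_pos hs).ne'
    have hnk : (n.choose k : ℂ) ≠ 0 := Nat.cast_ne_zero.mpr (Nat.choose_pos hk).ne'
    have hfac : (m.support.card.factorial : ℂ) ≠ 0 :=
      Nat.cast_ne_zero.mpr (Nat.factorial_ne_zero _)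
    have hcountC := congrArg (Nat.cast : ℕ → ℂ) hcount
    push_cast at hcountC ⊢
    field_simp
    linear_combination (-p.coeff m) * hcountC
end

section
/- Let p be a multilinear polynomial in n variables over ℂ such that p(0^n) ≠ 0, and suppose there exist r distinct integers i_1, ..., i_r ∈ {1, ..., n} such that p(x) = 0 for every x ∈ {0,1}^n with |x| ∈ {i_1, ..., i_r}. Then deg(p) ≥ r. -/
open Finset in
/-- The number of `k`-subsets of `α` containing a fixed set `S`. -/
theorem card_filter_subset_powersetCard_univ {α : Type*} [Fintype α] [DecidableEq α]
    (S : Finset α) {k : ℕ} (hk : #S ≤ k) :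
    #{T ∈ powersetCard k (univ : Finset α) | S ⊆ T} =
      (Fintype.card α - #S).choose (k - #S) := by
  rw [← card_compl, ← card_powersetCard]
  refine card_bij' (fun T _ => T \ S) (fun T _ => T ∪ S) ?_ ?_ ?_ ?_
  · intro T hT
    simp only [mem_filter, mem_powersetCard, subset_univ, true_and] at hT
    rw [mem_powersetCard, card_sdiff_of_subset hT.2, hT.1]
    exact ⟨fun x hx => mem_compl.2 (mem_sdiff.1 hx).2, rfl⟩
  · intro T hT
    rw [mem_powersetCard] at hT
    have hd : Disjoint T S := disjoint_left.2 fun x hx => mem_compl.1 (hT.1 hx)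
    simp only [mem_filter, mem_powersetCard, subset_univ, true_and, subset_union_right, and_true]
    rw [card_union_of_disjoint hd, hT.2]
    omega
  · intro T hT
    exact sdiff_union_of_subset (mem_filter.1 hT).2
  · intro T hT
    rw [mem_powersetCard] at hT
    exact union_sdiff_cancel_right (disjoint_left.2 fun x hx => mem_compl.1 (hT.1 hx))

open Finset in
theorem choose_mul_card_filter_subset_powersetCard_univ {α : Type*} [Fintype α] [DecidableEq α]
    (S : Finset α) (k : ℕ) :
    (Fintype.card α).choose #S * #{T ∈ powersetCard k (univ : Finset α) | S ⊆ T} =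
      (Fintype.card α).choose k * k.choose #S := by
  rcases le_or_gt #S k with h | h
  · rw [card_filter_subset_powersetCard_univ S h, Nat.choose_mul h]
  · rw [Nat.choose_eq_zero_of_lt h, mul_zero, mul_eq_zero, card_eq_zero, filter_eq_empty_iff]
    right
    intro T hT hST
    have := card_le_card hST
    rw [(mem_powersetCard.1 hT).2] at this
    omega

open Finset in
theorem hamWt_decide_mem {n : ℕ} (T : Finset (Fin n)) : hamWt (fun i => decide (i ∈ T)) = #T := by
  simp [hamWt]

open Finset in
theorem eval_bval_decide_mem {n : ℕ} (p : MvPolynomial (Fin n) ℂ) (T : Finset (Fin n)) :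
    MvPolynomial.eval (bval fun i => decide (i ∈ T)) p =
      ∑ m ∈ p.support, p.coeff m * if m.support ⊆ T then 1 else 0 := by
  rw [MvPolynomial.eval_eq]
  refine sum_congr rfl fun m _ => ?_
  congr 1
  split_ifs with h
  · exact prod_eq_one fun i hi => by simp [bval, h hi]
  · obtain ⟨i, hi, hiT⟩ := not_subset.1 h
    exact prod_eq_zero hi (by simp [bval, hiT, Finsupp.mem_support_iff.1 hi])

open Finset Nat in
/-- The univariate polynomial whose value at `k ≤ n` is the average of `p` over the Boolean
inputs of Hamming weight `k`. -/
noncomputable def symmetrization {n : ℕ} (p : MvPolynomial (Fin n) ℂ) : Polynomial ℂ :=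
  ∑ m ∈ p.support, Polynomial.C (p.coeff m / ((n.choose #m.support : ℂ) * (#m.support)!)) *
    descPochhammer ℂ #m.support

open Finset in
theorem natDegree_symmetrization_le {n : ℕ} (p : MvPolynomial (Fin n) ℂ) :
    (symmetrization p).natDegree ≤ p.totalDegree := by
  refine Polynomial.natDegree_sum_le_of_forall_le _ _ fun m hm => ?_
  refine (Polynomial.natDegree_C_mul_le _ _).trans ?_
  rw [descPochhammer_natDegree]
  refine le_trans ?_ (MvPolynomial.le_totalDegree hm)
  rw [card_eq_sum_ones]
  exact sum_le_sum fun i hi => Nat.one_le_iff_ne_zero.2 (Finsupp.mem_support_iff.1 hi)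

open Finset in
theorem choose_mul_eval_symmetrization {n k : ℕ} (p : MvPolynomial (Fin n) ℂ) :
    (n.choose k : ℂ) * (symmetrization p).eval (k : ℂ) =
      ∑ T ∈ powersetCard k univ, MvPolynomial.eval (bval fun i => decide (i ∈ T)) p := by
  simp_rw [eval_bval_decide_mem]
  rw [sum_comm, symmetrization, Polynomial.eval_finsetSum, mul_sum]
  refine sum_congr rfl fun m _ => ?_
  rw [← mul_sum, sum_boole, Polynomial.eval_mul, Polynomial.eval_C,
    descPochhammer_eval_eq_descFactorial, Nat.descFactorial_eq_factorial_mul_choose]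
  have h := choose_mul_card_filter_subset_powersetCard_univ m.support k
  rw [Fintype.card_fin] at h
  have hc : (n.choose #m.support : ℂ) ≠ 0 := by
    have : #m.support ≤ n := by simpa using card_le_univ m.support
    exact_mod_cast (Nat.choose_pos this).ne'
  have hf : ((#m.support).factorial : ℂ) ≠ 0 := by exact_mod_cast Nat.factorial_ne_zero _
  have h' := congrArg (Nat.cast : ℕ → ℂ) h
  push_cast at h' ⊢
  field_simp
  linear_combination -(p.coeff m) * h'

/-- If a multilinear polynomial `p` in `n` variables over `ℂ` is nonzero at
`0^n` and vanishes on all Boolean inputs whose Hamming weight lies in a set of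
`r` distinct integers from `{1, …, n}`, then `deg p ≥ r`. -/
theorem stmt_1 (n r : ℕ) (p : MvPolynomial (Fin n) ℂ)
    (hml : ∀ i : Fin n, p.degreeOf i ≤ 1)
    (h0 : MvPolynomial.eval (fun _ : Fin n => (0 : ℂ)) p ≠ 0)
    (I : Finset ℕ) (hI : I ⊆ Finset.Icc 1 n) (hr : I.card = r)
    (hz : ∀ x : Fin n → Bool, hamWt x ∈ I → MvPolynomial.eval (bval x) p = 0) :
    r ≤ p.totalDegree := by
  classical
  have hroot : ∀ k : I, (symmetrization p).eval ((k : ℕ) : ℂ) = 0 := by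
    intro k
    have hk : (k : ℕ) ≤ n := (Finset.mem_Icc.1 (hI k.2)).2
    have h := choose_mul_eval_symmetrization (k := k) p
    rw [Finset.sum_eq_zero fun T hT => hz _ (by
      rw [hamWt_decide_mem, (Finset.mem_powersetCard.1 hT).2]; exact k.2)] at h
    exact (mul_eq_zero.1 h).resolve_left (by exact_mod_cast (Nat.choose_pos hk).ne')
  have hzero : (symmetrization p).eval 0 ≠ 0 := by
    have h := choose_mul_eval_symmetrization (k := 0) p
    have hb : (bval fun i : Fin n => decide (i ∈ (∅ : Finset (Fin n)))) = fun _ => 0 := by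
      funext i
      simp [bval]
    rw [Finset.powersetCard_zero, Finset.sum_singleton, hb, Nat.choose_zero_right, Nat.cast_one,
      one_mul, Nat.cast_zero] at h
    rwa [h]
  by_contra! hlt
  have hq : symmetrization p = 0 :=
    Polynomial.eq_zero_of_natDegree_lt_card_of_eval_eq_zero _
      (f := fun k : I => ((k : ℕ) : ℂ)) (Nat.cast_injective.comp Subtype.val_injective) hroot
      (by
        rw [Fintype.card_coe, hr]
        exact (natDegree_symmetrization_le p).trans_lt hlt)
  exact hzero (by rw [hq, Polynomial.eval_zero])
end

section
/- Let 1 < m ≤ n be integers and let MOD_m : {0,1}^n → {0,1} be defined by MOD_m(x) = 1 if |x| ≡ 0 (mod m) and MOD_m(x) = 0 otherwise. Then every multilinear polynomial p in n variables over ℂ satisfying, for all x ∈ {0,1}^n, p(x) ≠ 0 if and only if |x| ≡ 0 (mod m), has degree deg(p) ≥ ⌈n(1 − 1/m)⌉. In particular, ndeg(MOD_m) ≥ ⌈n(1 − 1/m)⌉. -/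
open MvPolynomial in
/-- The signed sum over the Boolean cube of a polynomial of degree less than `n` vanishes. -/
theorem sum_sign_mul_eval_bval_eq_zero {n : ℕ} (r : MvPolynomial (Fin n) ℂ)
    (hr : r.totalDegree < n) :
    ∑ x : Fin n → Bool, (∏ i, if x i then (-1 : ℂ) else 1) * eval (bval x) r = 0 := by
  simp_rw [eval_eq', Finset.mul_sum]
  rw [Finset.sum_comm]
  refine Finset.sum_eq_zero fun s hs => ?_
  obtain ⟨i, hi⟩ : ∃ i, s i = 0 := by
    by_contra! h
    have h1 : s.sum (fun _ e => e) ≤ r.totalDegree := le_totalDegree hs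
    rw [Finsupp.sum_fintype _ _ fun _ => rfl] at h1
    have h2 : ∑ _i : Fin n, 1 ≤ ∑ i, s i :=
      Finset.sum_le_sum fun i _ => Nat.one_le_iff_ne_zero.mpr (h i)
    simp only [Finset.sum_const, Finset.card_univ, Fintype.card_fin, smul_eq_mul,
      mul_one] at h2
    omega
  have hprod : ∀ x : Fin n → Bool,
      (∏ i, if x i then (-1 : ℂ) else 1) * (coeff s r * ∏ i, bval x i ^ s i) =
        coeff s r * ∏ i, (if x i then (-1 : ℂ) else 1) * (if x i then (1 : ℂ) else 0) ^ s i := by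
    intro x
    rw [Finset.prod_mul_distrib]
    simp only [bval]
    ring
  simp_rw [hprod]
  rw [← Finset.mul_sum, ← Fintype.prod_sum (fun i (b : Bool) =>
    (if b then (-1 : ℂ) else 1) * (if b then (1 : ℂ) else 0) ^ s i),
    Finset.prod_eq_zero (Finset.mem_univ i) (by simp [hi]), mul_zero]

open MvPolynomial in
/-- A polynomial which is nonzero at exactly one point of the Boolean cube, the origin, has degree
at least `n`. -/
theorem le_totalDegree_of_eval_bval_eq_zero {n : ℕ} (r : MvPolynomial (Fin n) ℂ)
    (h0 : eval (bval fun _ => false) r ≠ 0)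
    (h : ∀ x : Fin n → Bool, x ≠ (fun _ => false) → eval (bval x) r = 0) :
    n ≤ r.totalDegree := by
  by_contra! hr
  have hsum := sum_sign_mul_eval_bval_eq_zero r hr
  rw [Finset.sum_eq_single (fun _ => false) (fun x _ hx => by rw [h x hx, mul_zero])
    (by simp)] at hsum
  simp [h0] at hsum

theorem sum_bval {n : ℕ} (x : Fin n → Bool) : ∑ i, bval x i = hamWt x := by
  simp [bval, hamWt]

/-- For `1 < m ≤ n`, any multilinear polynomial `p` in `n` variables over `ℂ`
with `p(x) ≠ 0 ↔ |x| ≡ 0 (mod m)` on the Boolean cube has degree at least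
`⌈n(1 - 1/m)⌉`; in particular `ndeg(MOD_m) ≥ ⌈n(1 - 1/m)⌉`. -/
theorem stmt_3 (n m : ℕ) (hm : 1 < m) (hmn : m ≤ n)
    (p : MvPolynomial (Fin n) ℂ)
    (hml : ∀ i : Fin n, p.degreeOf i ≤ 1)
    (hnd : ∀ x : Fin n → Bool,
      MvPolynomial.eval (bval x) p ≠ 0 ↔ hamWt x % m = 0) :
    ⌈(n : ℚ) * (1 - 1 / (m : ℚ))⌉ ≤ (p.totalDegree : ℤ) := by
  have hm0 : m ≠ 0 := by omega
  set q : MvPolynomial (Fin n) ℂ :=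
    ∏ j ∈ Finset.Icc 1 (n / m), (∑ i, MvPolynomial.X i - MvPolynomial.C ((m * j : ℕ) : ℂ)) with hq
  have hqdeg : q.totalDegree ≤ n / m := by
    refine (MvPolynomial.totalDegree_finsetProd _ _).trans
      ((Finset.sum_le_card_nsmul _ _ 1 ?_).trans ?_)
    · intro j _
      refine (MvPolynomial.totalDegree_sub_C_le _ _).trans (MvPolynomial.totalDegree_finsetSum_le fun i _ => ?_)
      rw [MvPolynomial.totalDegree_X]
    · simp
  have hqeval : ∀ x : Fin n → Bool, MvPolynomial.eval (bval x) q =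
      ∏ j ∈ Finset.Icc 1 (n / m), ((hamWt x : ℂ) - ((m * j : ℕ) : ℂ)) := by
    intro x
    simp only [hq, map_prod, map_sub, map_sum, MvPolynomial.eval_X, MvPolynomial.eval_C, sum_bval]
  have hn : n ≤ (p * q).totalDegree := by
    refine le_totalDegree_of_eval_bval_eq_zero _ ?_ fun x hx => ?_
    · have hw : hamWt (fun _ : Fin n => false) = 0 := by simp [hamWt]
      rw [map_mul, hqeval, hw]
      refine mul_ne_zero ((hnd _).mpr (by rw [hw, Nat.zero_mod]))
        (Finset.prod_ne_zero_iff.mpr fun j hj => ?_)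
      rw [Nat.cast_zero, zero_sub, neg_ne_zero, Nat.cast_ne_zero]
      exact mul_ne_zero hm0 (by have := (Finset.mem_Icc.mp hj).1; omega)
    · rw [map_mul]
      by_cases hmod : hamWt x % m = 0
      · have hpos : 0 < hamWt x := by
          obtain ⟨i, hi⟩ := Function.ne_iff.mp hx
          exact Finset.card_pos.mpr ⟨i, by simpa using hi⟩
        have hle : hamWt x ≤ n := by
          simpa [hamWt] using Finset.card_filter_le (Finset.univ : Finset (Fin n)) (x · = true)
        have hdvd := Nat.dvd_of_mod_eq_zero hmod
        rw [hqeval, Finset.prod_eq_zero (i := hamWt x / m), mul_zero]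
        · exact Finset.mem_Icc.mpr ⟨Nat.div_pos (Nat.le_of_dvd hpos hdvd) (by omega),
            Nat.div_le_div_right hle⟩
        · rw [Nat.mul_div_cancel' hdvd, sub_self]
      · rw [not_ne_iff.mp (mt (hnd x).mp hmod), zero_mul]
  have hdeg : n ≤ p.totalDegree + n / m :=
    hn.trans ((MvPolynomial.totalDegree_mul _ _).trans (Nat.add_le_add_left hqdeg _))
  have hdiv : ((n / m : ℕ) : ℚ) ≤ (n : ℚ) / m := Nat.cast_div_le
  have hdegQ : (n : ℚ) ≤ p.totalDegree + (n / m : ℕ) := by exact_mod_cast hdeg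
  rw [Int.ceil_le, mul_sub, mul_one, mul_one_div, Int.cast_natCast]
  linarith
end

section
/- For every x = (x₁,x₂,x₃) ∈ {0,1}³, the vector |ψ(x)⟩ = V · (QFT† O_x QFT) · U · (QFT† O_x QFT) · e₀ ∈ ℂ⁵ lies in the subspace S_{|x| mod 3}, where S₀ = span{e₀}, S₁ = span{e₁, e₂}, and S₂ = span{e₃, e₄}. Equivalently: if |x| ≡ 0 (mod 3) then the coordinates of ψ(x) with indices 1,2,3,4 all vanish; if |x| ≡ 1 (mod 3) then the coordinates with indices 0,3,4 all vanish; and if |x| ≡ 2 (mod 3) then the coordinates with indices 0,1,2 all vanish. In particular, measuring ψ(x) with respect to the orthogonal decomposition ℂ⁵ = S₀ ⊕ S₁ ⊕ S₂ yields |x| mod 3 with certainty. -/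
open Matrix

noncomputable section

/-- `ω = e^{2πi/3}`, a primitive cube root of unity. -/
def ω : ℂ := Complex.exp (2 * Real.pi * Complex.I / 3)

/-- The 3×3 quantum Fourier transform acting on the first three of five
basis states, and as the identity on the last two. -/
def QFT : Matrix (Fin 5) (Fin 5) ℂ :=
  ((Real.sqrt 3 : ℂ))⁻¹ •
    !![1, 1, 1, 0, 0;
       1, ω, ω ^ 2, 0, 0;
       1, ω ^ 2, ω, 0, 0;
       0, 0, 0, (Real.sqrt 3 : ℂ), 0;
       0, 0, 0, 0, (Real.sqrt 3 : ℂ)]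

/-- The first non-query unitary of the mod-3 algorithm. -/
def U : Matrix (Fin 5) (Fin 5) ℂ :=
  (1 / 4 : ℂ) •
    !![4, 0, 0, 0, 0;
       0, -(1/2) + Complex.I * (3 * (Real.sqrt 3 : ℂ) / 2), 0, 3, 0;
       0, 0, -(1/2) - Complex.I * (3 * (Real.sqrt 3 : ℂ) / 2), 0, 3;
       0, 3, 0, (1/2) + Complex.I * (3 * (Real.sqrt 3 : ℂ) / 2), 0;
       0, 0, 3, 0, (1/2) - Complex.I * (3 * (Real.sqrt 3 : ℂ) / 2)]

/-- The second non-query unitary of the mod-3 algorithm. -/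
def V : Matrix (Fin 5) (Fin 5) ℂ :=
  ((Real.sqrt 2 : ℂ))⁻¹ •
    !![(Real.sqrt 2 : ℂ), 0, 0, 0, 0;
       0, (1/2) - Complex.I * ((Real.sqrt 3 : ℂ) / 2), 0, 1, 0;
       0, 0, (1/2) + Complex.I * ((Real.sqrt 3 : ℂ) / 2), 0, 1;
       0, 1, 0, -(1/2) - Complex.I * ((Real.sqrt 3 : ℂ) / 2), 0;
       0, 0, 1, 0, -(1/2) + Complex.I * ((Real.sqrt 3 : ℂ) / 2)]

/-- The phase oracle for a 3-bit input, acting trivially on the last two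
dimensions: `O_x = diag((-1)^{x₁}, (-1)^{x₂}, (-1)^{x₃}, 1, 1)`. -/
def Ox (x : Fin 3 → Bool) : Matrix (Fin 5) (Fin 5) ℂ :=
  !![(if x 0 then -1 else 1 : ℂ), 0, 0, 0, 0;
     0, (if x 1 then -1 else 1 : ℂ), 0, 0, 0;
     0, 0, (if x 2 then -1 else 1 : ℂ), 0, 0;
     0, 0, 0, 1, 0;
     0, 0, 0, 0, 1]

/-- The final state of the 2-query mod-3 algorithm:
`|ψ(x)⟩ = V (QFT† O_x QFT) U (QFT† O_x QFT) e₀`. -/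
def ψ (x : Fin 3 → Bool) : Fin 5 → ℂ :=
  (V * (QFTᴴ * Ox x * QFT) * U * (QFTᴴ * Ox x * QFT)).mulVec
    (Pi.single (0 : Fin 5) (1 : ℂ))

end

theorem I_mul_sqrt_three : Complex.I * (Real.sqrt 3 : ℂ) = 2 * ω + 1 := by
  have h : (2 * Real.pi * Complex.I / 3 : ℂ) = ((2 * Real.pi / 3 : ℝ) : ℂ) * Complex.I := by
    push_cast; ring
  have e : (2 * Real.pi / 3 : ℝ) = Real.pi - Real.pi / 3 := by ring
  rw [ω, h, Complex.exp_mul_I, ← Complex.ofReal_cos, ← Complex.ofReal_sin, e,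
    Real.cos_pi_sub, Real.sin_pi_sub, Real.cos_pi_div_three, Real.sin_pi_div_three]
  push_cast
  ring

theorem sqrt_three_sq : (Real.sqrt 3 : ℂ) ^ 2 = 3 := by
  rw [← Complex.ofReal_pow, Real.sq_sqrt (by norm_num)]
  norm_num

theorem omega_sq_add : ω ^ 2 + ω + 1 = 0 := by
  linear_combination (-1 / 4 : ℂ) * (Complex.I * (Real.sqrt 3 : ℂ) + 2 * ω + 1) *
    I_mul_sqrt_three + (1 / 4 : ℂ) * (Real.sqrt 3 : ℂ) ^ 2 * Complex.I_sq
    - (1 / 4 : ℂ) * sqrt_three_sq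

theorem conj_omega : (starRingEnd ℂ) ω = -1 - ω := by
  have h := I_mul_sqrt_three
  have h' := congrArg (starRingEnd ℂ) h
  simp only [map_mul, map_add, Complex.conj_I, Complex.conj_ofReal, map_one, map_ofNat] at h'
  linear_combination (-1 / 2 : ℂ) * (h + h')

/-- The oracle conjugated by the Fourier transform is a circulant block plus the identity. -/
theorem conjTranspose_QFT_mul_Ox_mul_QFT (x : Fin 3 → Bool) (a b c : ℂ)
    (ha : a = if x 0 then -1 else 1) (hb : b = if x 1 then -1 else 1)
    (hc : c = if x 2 then -1 else 1) :
    QFTᴴ * Ox x * QFT = (1 / 3 : ℂ) •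
      !![a + b + c, a + b * ω + c * ω ^ 2, a + b * ω ^ 2 + c * ω, 0, 0;
         a + b * ω ^ 2 + c * ω, a + b + c, a + b * ω + c * ω ^ 2, 0, 0;
         a + b * ω + c * ω ^ 2, a + b * ω ^ 2 + c * ω, a + b + c, 0, 0;
         0, 0, 0, 3, 0;
         0, 0, 0, 0, 3] := by
  have hw := omega_sq_add
  have hs := sqrt_three_sq
  have hi : (Real.sqrt 3 : ℂ)⁻¹ * (Real.sqrt 3 : ℂ)⁻¹ = 1 / 3 := by
    rw [← mul_inv, ← sq, hs, one_div]
  have hO : Ox x = !![a, 0, 0, 0, 0; 0, b, 0, 0, 0; 0, 0, c, 0, 0;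
      0, 0, 0, 1, 0; 0, 0, 0, 0, 1] := by
    rw [ha, hb, hc]; rfl
  have hstar : star (Real.sqrt 3 : ℂ) = (Real.sqrt 3 : ℂ) := Complex.conj_ofReal _
  rw [hO, QFT, conjTranspose_smul, smul_mul_assoc, smul_mul_assoc, mul_smul_comm, smul_smul,
    star_inv₀, hstar, hi]
  clear ha hb hc hO hi hstar
  congr 1
  ext i j
  fin_cases i <;> fin_cases j <;>
    simp [Matrix.mul_apply, Fin.sum_univ_five, conj_omega] <;> grind

theorem U_eq : U = (1 / 4 : ℂ) •
    !![4, 0, 0, 0, 0;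
       0, 1 + 3 * ω, 0, 3, 0;
       0, 0, -2 - 3 * ω, 0, 3;
       0, 3, 0, 2 + 3 * ω, 0;
       0, 0, 3, 0, -1 - 3 * ω] := by
  have h := I_mul_sqrt_three
  rw [U]
  congr 1
  ext i j
  fin_cases i <;> fin_cases j <;> simp <;> grind

theorem V_eq : V = (Real.sqrt 2 : ℂ)⁻¹ •
    !![(Real.sqrt 2 : ℂ), 0, 0, 0, 0;
       0, -ω, 0, 1, 0;
       0, 0, 1 + ω, 0, 1;
       0, 1, 0, -1 - ω, 0;
       0, 0, 1, 0, ω] := by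
  have h := I_mul_sqrt_three
  rw [V]
  congr 1
  ext i j
  fin_cases i <;> fin_cases j <;> simp <;> grind

theorem hamWt_three (x : Fin 3 → Bool) :
    hamWt x = (if x 0 then 1 else 0) + (if x 1 then 1 else 0) + (if x 2 then 1 else 0) := by
  rw [hamWt, Finset.card_filter, Fin.sum_univ_three]

/-- Correctness of the mod-3 algorithm: `|ψ(x)⟩` lies in the subspace
`S_{|x| mod 3}`, where `S₀ = span{e₀}`, `S₁ = span{e₁, e₂}`,
`S₂ = span{e₃, e₄}`. -/
theorem stmt_11 (x : Fin 3 → Bool) :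
    (hamWt x % 3 = 0 → ψ x 1 = 0 ∧ ψ x 2 = 0 ∧ ψ x 3 = 0 ∧ ψ x 4 = 0) ∧
    (hamWt x % 3 = 1 → ψ x 0 = 0 ∧ ψ x 3 = 0 ∧ ψ x 4 = 0) ∧
    (hamWt x % 3 = 2 → ψ x 0 = 0 ∧ ψ x 1 = 0 ∧ ψ x 2 = 0) := by
  have hw := omega_sq_add
  simp only [ψ, ← Matrix.mulVec_mulVec, conjTranspose_QFT_mul_Ox_mul_QFT x _ _ _ rfl rfl rfl,
    U_eq, V_eq, Matrix.smul_mulVec]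
  cases h0 : x 0 <;> cases h1 : x 1 <;> cases h2 : x 2 <;>
    simp [hamWt_three, h0, h1, h2, dotProduct, Fin.sum_univ_five] <;> grind
end
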